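/- There exist two non-isomorphic finite simple graphs with equal feature data: the graph G₁ obtained from a 4-cycle by attaching a pendant edge at each of two adjacent vertices of the cycle, and the graph G₂ obtained from a 4-cycle by attaching a pendant edge at each of two opposite (non-adjacent) vertices of the cycle, are not isomorphic, yet they have the same number of vertices, the same number of edges, the same clique number, the same multiset of vertex degrees, and the same multiset of pairs (degree, number of cliques containing the vertex). -/

import Mathlib

namespace PaperStmt

/-- The 4-cycle `0-1-2-3-0` with pendant edges attached at the two *adjacent* cycle
vertices `0` and `1` (pendant vertices `4` and `5`). -/
def G₁ : SimpleGraph (Fin 6) :=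
  SimpleGraph.fromEdgeSet {s(0, 1), s(1, 2), s(2, 3), s(3, 0), s(0, 4), s(1, 5)}

/-- The 4-cycle `0-1-2-3-0` with pendant edges attached at the two *opposite* cycle
vertices `0` and `2` (pendant vertices `4` and `5`). -/
def G₂ : SimpleGraph (Fin 6) :=
  SimpleGraph.fromEdgeSet {s(0, 1), s(1, 2), s(2, 3), s(3, 0), s(0, 4), s(2, 5)}

/-- The degree of a vertex `v` of a simple graph. -/
noncomputable def degS (H : SimpleGraph (Fin 6)) (v : Fin 6) : ℕ :=
  Nat.card {u : Fin 6 // H.Adj v u}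

/-- The number of (nonempty) cliques of `H` containing the vertex `v`. -/
noncomputable def cqS (H : SimpleGraph (Fin 6)) (v : Fin 6) : ℕ :=
  Nat.card {s : Finset (Fin 6) // s.Nonempty ∧ H.IsClique ↑s ∧ v ∈ s}

/-- The clique number of `H`: the size of a largest (nonempty) clique. -/
noncomputable def cliqueNumS (H : SimpleGraph (Fin 6)) : ℕ :=
  sSup {k : ℕ | ∃ s : Finset (Fin 6), s.Nonempty ∧ H.IsClique ↑s ∧ s.card = k}

instance decAdj₁ : DecidableRel G₁.Adj := fun a b =>
  decidable_of_iff (a ≠ b ∧ (s(a, b) = s(0, 1) ∨ s(a, b) = s(1, 2) ∨ s(a, b) = s(2, 3) ∨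
    s(a, b) = s(3, 0) ∨ s(a, b) = s(0, 4) ∨ s(a, b) = s(1, 5))) (by
    rw [G₁, SimpleGraph.fromEdgeSet_adj, and_comm]; rfl)

instance decAdj₂ : DecidableRel G₂.Adj := fun a b =>
  decidable_of_iff (a ≠ b ∧ (s(a, b) = s(0, 1) ∨ s(a, b) = s(1, 2) ∨ s(a, b) = s(2, 3) ∨
    s(a, b) = s(3, 0) ∨ s(a, b) = s(0, 4) ∨ s(a, b) = s(2, 5))) (by
    rw [G₂, SimpleGraph.fromEdgeSet_adj, and_comm]; rfl)

/-- Computable degree. -/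
def degC (H : SimpleGraph (Fin 6)) [DecidableRel H.Adj] (v : Fin 6) : ℕ :=
  (Finset.univ.filter fun u => H.Adj v u).card

/-- Computable clique predicate. -/
abbrev CliqueC (H : SimpleGraph (Fin 6)) (s : Finset (Fin 6)) : Prop :=
  ∀ a ∈ s, ∀ b ∈ s, a ≠ b → H.Adj a b

/-- Computable clique count. -/
def cqC (H : SimpleGraph (Fin 6)) [DecidableRel H.Adj] (v : Fin 6) : ℕ :=
  ((Finset.univ : Finset (Finset (Fin 6))).filter fun s =>
    s.Nonempty ∧ CliqueC H s ∧ v ∈ s).card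

theorem cliqueC_iff (H : SimpleGraph (Fin 6)) (s : Finset (Fin 6)) :
    H.IsClique (s : Set (Fin 6)) ↔ CliqueC H s := by
  constructor
  · intro h a ha b hb hab
    exact h ha hb hab
  · intro h a ha b hb hab
    exact h a ha b hb hab

theorem degS_eq (H : SimpleGraph (Fin 6)) [DecidableRel H.Adj] (v : Fin 6) :
    degS H v = degC H v := by
  rw [degS, degC, Nat.card_eq_fintype_card, Fintype.card_subtype]

theorem cqS_eq (H : SimpleGraph (Fin 6)) [DecidableRel H.Adj] (v : Fin 6) :
    cqS H v = cqC H v := by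
  simp only [cqS, cqC, cliqueC_iff]
  rw [Nat.card_eq_fintype_card, Fintype.card_subtype]

theorem cliqueNumS_eq_two (H : SimpleGraph (Fin 6)) (h01 : CliqueC H {0, 1})
    (h : ∀ s : Finset (Fin 6), CliqueC H s → s.card ≤ 2) : cliqueNumS H = 2 := by
  apply IsGreatest.csSup_eq
  constructor
  · exact ⟨{0, 1}, by simp, (cliqueC_iff _ _).2 h01, by decide⟩
  · rintro k ⟨s, -, hs, rfl⟩
    exact h s ((cliqueC_iff _ _).1 hs)

theorem not_iso : ¬ Nonempty (G₁ ≃g G₂) := by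
  rintro ⟨f⟩
  have hd : ∀ v, degC G₁ v = degC G₂ (f v) := by
    intro v
    rw [← degS_eq, ← degS_eq]
    exact Nat.card_congr (f.toEquiv.subtypeEquiv fun u => f.map_adj_iff.symm)
  have key : ∀ a b : Fin 6, G₂.Adj a b → ¬ (degC G₂ a = 3 ∧ degC G₂ b = 3) := by
    decide +kernel
  have h01 : G₁.Adj 0 1 := by decide +kernel
  refine key (f 0) (f 1) (f.map_adj_iff.2 h01) ⟨?_, ?_⟩
  · rw [← hd]; decide +kernel
  · rw [← hd]; decide +kernel

/-- `G₁` and `G₂` are non-isomorphic finite simple graphs that share the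
same number of vertices, number of edges, clique number, multiset of vertex degrees,
and multiset of pairs (degree, number of cliques containing the vertex). -/
theorem non_isomorphic_graphs_with_equal_feature_data :
    (¬ Nonempty (G₁ ≃g G₂)) ∧
    Fintype.card (Fin 6) = Fintype.card (Fin 6) ∧
    Nat.card G₁.edgeSet = Nat.card G₂.edgeSet ∧
    cliqueNumS G₁ = cliqueNumS G₂ ∧
    (Finset.univ.val.map fun v => degS G₁ v) = (Finset.univ.val.map fun v => degS G₂ v) ∧
    (Finset.univ.val.map fun v => (degS G₁ v, cqS G₁ v))
      = (Finset.univ.val.map fun v => (degS G₂ v, cqS G₂ v)) := by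
  refine ⟨not_iso, rfl, ?_, ?_, ?_, ?_⟩
  · rw [Nat.card_eq_fintype_card, Nat.card_eq_fintype_card]
    decide +kernel
  · rw [cliqueNumS_eq_two G₁ (by decide +kernel) (by decide +kernel),
      cliqueNumS_eq_two G₂ (by decide +kernel) (by decide +kernel)]
  · simp only [degS_eq]
    decide +kernel
  · simp only [degS_eq, cqS_eq]
    decide +kernel

end PaperStmt
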